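/- arXiv:math/0511722 — 7 statements merged into one kernel-verified Lean document; each statement's English description precedes it below -/
import Mathlib

section
/- Let D₀, Y₀, X̃₀, X̃₁, X₁, U₁ be abelian groups with group homomorphisms j : X̃₁ → U₁, δ : U₁ → D₀, i : D₀ → X̃₀, π : D₀ → Y₀, σ : X̃₁ → X₁, j₀ : X₁ → U₁, δ₀ : U₁ → Y₀ satisfying: (i) ker i ⊆ im δ; (ii) δ ∘ j = 0; (iii) ker δ₀ ⊆ im j₀; (iv) δ₀ = π ∘ δ; (v) j = j₀ ∘ σ; (vi) σ is surjective. Then any x ∈ D₀ with i(x) = 0 and π(x) = 0 satisfies x = 0. -/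
/-- Diagram chase for Proposition 2.1 of the paper:
groups D₀, Y₀, X̃₀, X̃₁, X₁, U₁ with homs j : X̃₁ → U₁, δ : U₁ → D₀,
i : D₀ → X̃₀, π : D₀ → Y₀, σ : X̃₁ → X₁, j₀ : X₁ → U₁, δ₀ : U₁ → Y₀ with
(i) ker i ⊆ im δ; (ii) δ ∘ j = 0; (iii) ker δ₀ ⊆ im j₀; (iv) δ₀ = π ∘ δ;
(v) j = j₀ ∘ σ; (vi) σ surjective. Then x ∈ D₀ with i(x) = 0 and π(x) = 0
satisfies x = 0. -/
theorem stmt_1 {D0 Y0 Xt0 Xt1 X1 U1 : Type*} [AddCommGroup D0] [AddCommGroup Y0]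
    [AddCommGroup Xt0] [AddCommGroup Xt1] [AddCommGroup X1] [AddCommGroup U1]
    (j : Xt1 →+ U1) (δ : U1 →+ D0) (i : D0 →+ Xt0) (π : D0 →+ Y0)
    (σ : Xt1 →+ X1) (j0 : X1 →+ U1) (δ0 : U1 →+ Y0)
    (h1 : ∀ x : D0, i x = 0 → ∃ u : U1, δ u = x)
    (h2 : ∀ x : Xt1, δ (j x) = 0)
    (h3 : ∀ u : U1, δ0 u = 0 → ∃ x : X1, j0 x = u)
    (h4 : ∀ u : U1, δ0 u = π (δ u))
    (h5 : ∀ x : Xt1, j x = j0 (σ x))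
    (h6 : Function.Surjective σ) :
    ∀ x : D0, i x = 0 → π x = 0 → x = 0 := by
  intro x hi hp
  obtain ⟨u, rfl⟩ := h1 x hi
  obtain ⟨y, rfl⟩ := h3 u ((h4 u).trans hp)
  obtain ⟨z, rfl⟩ := h6 y
  rw [← h5]
  exact h2 z
end

section
/- Let X̃_L, X_L, U_L, D_L, Y_L and X̃_H, X_H, U_H, D_H, Y_H, U′_H be abelian groups with group homomorphisms σ_L : X̃_L → X_L, i_L : D_L → X̃_L, i₀_L : Y_L → X_L, j_L : X̃_L → U_L, j₀_L : X_L → U_L, π_L : D_L → Y_L, and i_H : D_H → X̃_H, i₀_H : Y_H → X_H, j_H : X̃_H → U_H, j₀_H : X_H → U_H, π_H : D_H → Y_H, σ_H : X̃_H → X_H, δ_H : U′_H → D_H, δ₀_H : U′_H → Y_H, together with homomorphisms Φ_X̃ : X̃_L → X̃_H, Φ_X : X_L → X_H, Φ_U : U_L → U_H, Φ_D : D_L → D_H, satisfying: (1) σ_L is surjective; (2) Φ_U ∘ j_L = j_H ∘ Φ_X̃; (3) j_L = j₀_L ∘ σ_L; (4) Φ_U ∘ j₀_L = j₀_H ∘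 Φ_X; (5) Φ_X ∘ σ_L = σ_H ∘ Φ_X̃; (6) ker j_H ⊆ im i_H; (7) σ_H ∘ i_H = i₀_H ∘ π_H; (8) ker i₀_H ⊆ im δ₀_H; (9) π_H ∘ δ_H = δ₀_H; (10) i_H ∘ δ_H = 0; (11) for every x ∈ D_H with π_H(x) = 0 there exists e ∈ D_L with π_L(e) = 0 and Φ_D(e) = x; (12) σ_L ∘ i_L = i₀_L ∘ π_L; (13) Φ_X̃ ∘ i_L = i_H ∘ Φ_D. Then for every a ∈ X_L with Φ_X(a) = 0 there exists ã ∈ X̃_L with Φ_X̃(ã) = 0 and σ_L(ã) = a. -/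
/-- Case B of the main theorem for p = 1 (surjectivity of
σ_* : L₁H_k(X̃)_hom → L₁H_k(X)_hom). -/
theorem stmt_4 {XtL XL UL DL YL XtH XH UH DH YH U'H : Type*}
    [AddCommGroup XtL] [AddCommGroup XL] [AddCommGroup UL] [AddCommGroup DL]
    [AddCommGroup YL] [AddCommGroup XtH] [AddCommGroup XH] [AddCommGroup UH]
    [AddCommGroup DH] [AddCommGroup YH] [AddCommGroup U'H]
    (σL : XtL →+ XL) (iL : DL →+ XtL) (i0L : YL →+ XL)
    (jL : XtL →+ UL) (j0L : XL →+ UL) (πL : DL →+ YL)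
    (iH : DH →+ XtH) (i0H : YH →+ XH) (jH : XtH →+ UH) (j0H : XH →+ UH)
    (πH : DH →+ YH) (σH : XtH →+ XH) (δH : U'H →+ DH) (δ0H : U'H →+ YH)
    (ΦXt : XtL →+ XtH) (ΦX : XL →+ XH) (ΦU : UL →+ UH) (ΦD : DL →+ DH)
    (h1 : Function.Surjective σL)
    (h2 : ∀ a : XtL, ΦU (jL a) = jH (ΦXt a))
    (h3 : ∀ a : XtL, jL a = j0L (σL a))
    (h4 : ∀ a : XL, ΦU (j0L a) = j0H (ΦX a))
    (h5 : ∀ a : XtL, ΦX (σL a) = σH (ΦXt a))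
    (h6 : ∀ x : XtH, jH x = 0 → ∃ d : DH, iH d = x)
    (h7 : ∀ d : DH, σH (iH d) = i0H (πH d))
    (h8 : ∀ y : YH, i0H y = 0 → ∃ u : U'H, δ0H u = y)
    (h9 : ∀ u : U'H, πH (δH u) = δ0H u)
    (h10 : ∀ u : U'H, iH (δH u) = 0)
    (h11 : ∀ x : DH, πH x = 0 → ∃ e : DL, πL e = 0 ∧ ΦD e = x)
    (h12 : ∀ d : DL, σL (iL d) = i0L (πL d))
    (h13 : ∀ d : DL, ΦXt (iL d) = iH (ΦD d)) :
    ∀ a : XL, ΦX a = 0 → ∃ ta : XtL, ΦXt ta = 0 ∧ σL ta = a := by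
  intro a ha
  obtain ⟨b, rfl⟩ := h1 a
  obtain ⟨d, hd⟩ := h6 (ΦXt b) (by rw [← h2, h3, h4, ha, map_zero])
  obtain ⟨u, hu⟩ := h8 (πH d) (by rw [← h7, hd, ← h5, ha])
  obtain ⟨e, he, hx⟩ := h11 (d - δH u) (by rw [map_sub, h9, hu, sub_self])
  refine ⟨b - iL e, ?_, ?_⟩
  · rw [map_sub, h13, hx, map_sub, h10, sub_zero, hd, sub_self]
  · rw [map_sub, h12, he, map_zero, sub_zero]
end

section
/- Let U′_L, D_L, Y_L, X̃_L, X_L, U_L and D_H, Y_H, X̃_H, X̃′_H, X′_H, U″_H be abelian groups with group homomorphisms δ_L : U′_L → D_L, δ₀_L : U′_L → Y_L, i_L : D_L → X̃_L, i₀_L : Y_L → X_L, j_L : X̃_L → U_L, j₀_L : X_L → U_L, π_L : D_L → Y_L, σ_L : X̃_L → X_L, and i_H : D_H → X̃_H, π_H : D_H → Y_H, δ_H : U″_H → D_H, δ₀_H : U″_H → Y_H, j_H : X̃′_H → U″_H, j₀_H : X′_H → U″_H, σ_H : X̃′_H → X′_H, together with homomorphisms Φ_X̃ : X̃_L → X̃_H,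 Φ_D : D_L → D_H, Φ_Y : Y_L → Y_H, satisfying: (1) ker j_L ⊆ im i_L; (2) ker i₀_L ⊆ im δ₀_L; (3) i_L ∘ δ_L = 0; (4) π_L ∘ δ_L = δ₀_L; (5) σ_L ∘ i_L = i₀_L ∘ π_L; (6) j_L = j₀_L ∘ σ_L; (7) Φ_Y ∘ π_L = π_H ∘ Φ_D; (8) Φ_X̃ ∘ i_L = i_H ∘ Φ_D; (9) Φ_D is injective; (10) ker i_H ⊆ im δ_H; (11) δ_H ∘ j_H = 0; (12) ker δ₀_H ⊆ im j₀_H; (13) δ₀_H = π_H ∘ δ_H; (14) j_H = j₀_H ∘ σ_H; (15) σ_H is surjective. Then any a ∈ X̃_L with Φ_X̃(a) = 0 and σ_L(a) = 0 satisfies a = 0. -/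
/-- Case 1 of the main theorem for p = n−2 (injectivity of
σ_* : L_{n−2}H_k(X̃)_hom → L_{n−2}H_k(X)_hom). -/
theorem stmt_5 {U'L DL YL XtL XL UL DH YH XtH Xt'H X'H U''H : Type*}
    [AddCommGroup U'L] [AddCommGroup DL] [AddCommGroup YL] [AddCommGroup XtL]
    [AddCommGroup XL] [AddCommGroup UL] [AddCommGroup DH] [AddCommGroup YH]
    [AddCommGroup XtH] [AddCommGroup Xt'H] [AddCommGroup X'H] [AddCommGroup U''H]
    (δL : U'L →+ DL) (δ0L : U'L →+ YL) (iL : DL →+ XtL) (i0L : YL →+ XL)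
    (jL : XtL →+ UL) (j0L : XL →+ UL) (πL : DL →+ YL) (σL : XtL →+ XL)
    (iH : DH →+ XtH) (πH : DH →+ YH) (δH : U''H →+ DH) (δ0H : U''H →+ YH)
    (jH : Xt'H →+ U''H) (j0H : X'H →+ U''H) (σH : Xt'H →+ X'H)
    (ΦXt : XtL →+ XtH) (ΦD : DL →+ DH) (ΦY : YL →+ YH)
    (h1 : ∀ a : XtL, jL a = 0 → ∃ b : DL, iL b = a)
    (h2 : ∀ y : YL, i0L y = 0 → ∃ c : U'L, δ0L c = y)
    (h3 : ∀ c : U'L, iL (δL c) = 0)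
    (h4 : ∀ c : U'L, πL (δL c) = δ0L c)
    (h5 : ∀ b : DL, σL (iL b) = i0L (πL b))
    (h6 : ∀ a : XtL, jL a = j0L (σL a))
    (h7 : ∀ b : DL, ΦY (πL b) = πH (ΦD b))
    (h8 : ∀ b : DL, ΦXt (iL b) = iH (ΦD b))
    (h9 : Function.Injective ΦD)
    (h10 : ∀ x : DH, iH x = 0 → ∃ u : U''H, δH u = x)
    (h11 : ∀ x : Xt'H, δH (jH x) = 0)
    (h12 : ∀ u : U''H, δ0H u = 0 → ∃ x : X'H, j0H x = u)
    (h13 : ∀ u : U''H, δ0H u = πH (δH u))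
    (h14 : ∀ x : Xt'H, jH x = j0H (σH x))
    (h15 : Function.Surjective σH) :
    ∀ a : XtL, ΦXt a = 0 → σL a = 0 → a = 0 := by
  intro a ha hs
  obtain ⟨b, rfl⟩ := h1 a (by rw [h6, hs, map_zero])
  obtain ⟨c, hc⟩ := h2 (πL b) (by rw [← h5, hs])
  have hi : iL (b - δL c) = iL b := by rw [map_sub, h3, sub_zero]
  have hp : πL (b - δL c) = 0 := by rw [map_sub, h4, hc, sub_self]
  obtain ⟨u, hu⟩ := h10 (ΦD (b - δL c)) (by rw [← h8, hi, ha])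
  obtain ⟨x, hx⟩ := h12 u (by rw [h13, hu, ← h7, hp, map_zero])
  obtain ⟨y, rfl⟩ := h15 x
  have hz : ΦD (b - δL c) = 0 := by rw [← hu, ← hx, ← h14, h11]
  have hb : b - δL c = 0 := h9 (by rw [hz, map_zero])
  rw [← hi, hb, map_zero]
end

section
/- Let U′_L, D_L, Y_L, X̃_L, X_L and D_H, Y_H, X̃_H, X̃′_H, X′_H, U″_H be abelian groups with group homomorphisms δ_L : U′_L → D_L, δ₀_L : U′_L → Y_L, i_L : D_L → X̃_L, i₀_L : Y_L → X_L, π_L : D_L → Y_L, σ_L : X̃_L → X_L, and i_H : D_H → X̃_H, π_H : D_H → Y_H, δ_H : U″_H → D_H, δ₀_H : U″_H → Y_H, j_H : X̃′_H → U″_H, j₀_H : X′_H → U″_H, σ_H : X̃′_H → X′_H, together with homomorphisms Φ_X̃ : X̃_L → X̃_H, Φ_D : D_L → D_H, Φ_Y : Y_L → Y_H, satisfying: (1) ker i₀_L ⊆ im δ₀_L; (2) i_L ∘ δ_L = 0; (3) π_L ∘ δ_L = δ₀_L; (4) σ_L ∘ i_L = i₀_L ∘ π_L; (5) Φ_Y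 ∘ π_L = π_H ∘ Φ_D; (6) Φ_X̃ ∘ i_L = i_H ∘ Φ_D; (7) Φ_D is injective; (8) ker i_H ⊆ im δ_H; (9) δ_H ∘ j_H = 0; (10) ker δ₀_H ⊆ im j₀_H; (11) δ₀_H = π_H ∘ δ_H; (12) j_H = j₀_H ∘ σ_H; (13) σ_H is surjective. Then for any b ∈ D_L with σ_L(i_L(b)) = 0 and Φ_X̃(i_L(b)) = 0 there exists c ∈ U′_L such that δ₀_L(c) = π_L(b) and δ_L(c) = b. -/
/-- the boxed Claim in Case 1 of the proof of the main theorem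
for p = n−2. -/
theorem stmt_6 {U'L DL YL XtL XL DH YH XtH Xt'H X'H U''H : Type*}
    [AddCommGroup U'L] [AddCommGroup DL] [AddCommGroup YL] [AddCommGroup XtL]
    [AddCommGroup XL] [AddCommGroup DH] [AddCommGroup YH] [AddCommGroup XtH]
    [AddCommGroup Xt'H] [AddCommGroup X'H] [AddCommGroup U''H]
    (δL : U'L →+ DL) (δ0L : U'L →+ YL) (iL : DL →+ XtL) (i0L : YL →+ XL)
    (πL : DL →+ YL) (σL : XtL →+ XL)
    (iH : DH →+ XtH) (πH : DH →+ YH) (δH : U''H →+ DH) (δ0H : U''H →+ YH)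
    (jH : Xt'H →+ U''H) (j0H : X'H →+ U''H) (σH : Xt'H →+ X'H)
    (ΦXt : XtL →+ XtH) (ΦD : DL →+ DH) (ΦY : YL →+ YH)
    (h1 : ∀ y : YL, i0L y = 0 → ∃ c : U'L, δ0L c = y)
    (h2 : ∀ c : U'L, iL (δL c) = 0)
    (h3 : ∀ c : U'L, πL (δL c) = δ0L c)
    (h4 : ∀ b : DL, σL (iL b) = i0L (πL b))
    (h5 : ∀ b : DL, ΦY (πL b) = πH (ΦD b))
    (h6 : ∀ b : DL, ΦXt (iL b) = iH (ΦD b))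
    (h7 : Function.Injective ΦD)
    (h8 : ∀ x : DH, iH x = 0 → ∃ u : U''H, δH u = x)
    (h9 : ∀ x : Xt'H, δH (jH x) = 0)
    (h10 : ∀ u : U''H, δ0H u = 0 → ∃ x : X'H, j0H x = u)
    (h11 : ∀ u : U''H, δ0H u = πH (δH u))
    (h12 : ∀ x : Xt'H, jH x = j0H (σH x))
    (h13 : Function.Surjective σH) :
    ∀ b : DL, σL (iL b) = 0 → ΦXt (iL b) = 0 →
      ∃ c : U'L, δ0L c = πL b ∧ δL c = b := by
  intro b hb hb'
  obtain ⟨c, hc⟩ := h1 (πL b) (by rw [← h4, hb])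
  refine ⟨c, hc, ?_⟩
  have hπ : πL (b - δL c) = 0 := by rw [map_sub, h3, hc, sub_self]
  have hi : iH (ΦD (b - δL c)) = 0 := by
    rw [← h6, map_sub, h2, sub_zero, hb']
  obtain ⟨u, hu⟩ := h8 _ hi
  have hu0 : δ0H u = 0 := by rw [h11, hu, ← h5, hπ, map_zero]
  obtain ⟨x, hx⟩ := h10 u hu0
  obtain ⟨y, hy⟩ := h13 x
  have hz : δH u = 0 := by rw [← hx, ← hy, ← h12, h9]
  have hd : b - δL c = 0 := h7 (by rw [← hu, hz, map_zero])
  exact (sub_eq_zero.mp hd).symm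
end

section
/- Let U_L, D_L, D′_L, X̃_L and U_H, D_H, D′_H, X̃_H be abelian groups with group homomorphisms δ_L : U_L → D′_L, j_L : X̃_L → U_L, i_L : D_L → X̃_L, and δ_H : U_H → D′_H, j_H : X̃_H → U_H, i_H : D_H → X̃_H, together with homomorphisms Φ_U : U_L → U_H, Φ_X̃ : X̃_L → X̃_H, Φ_D : D_L → D_H, Φ_{D′} : D′_L → D′_H, satisfying: (1) Φ_{D′} is injective; (2) Φ_D is surjective; (3) Φ_{D′} ∘ δ_L = δ_H ∘ Φ_U; (4) ker δ_L ⊆ im j_L; (5) j_H ∘ Φ_X̃ = Φ_U ∘ j_L; (6) ker j_H ⊆ im i_H; (7) Φ_X̃ ∘ i_L = i_H ∘ Φ_D; (8) j_L ∘ i_L = 0. Then for every a ∈ U_L with Φ_U(a) = 0 there exists b ∈ X̃_L with Φ_X̃(b) = 0 and j_L(b) = a. -/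
/-- Case 2 (subcases (b) and (c)) of the main theorem for p = n−2:
surjectivity of the restriction j* on hom-trivial parts. -/
theorem stmt_7 {UL DL D'L XtL UH DH D'H XtH : Type*}
    [AddCommGroup UL] [AddCommGroup DL] [AddCommGroup D'L] [AddCommGroup XtL]
    [AddCommGroup UH] [AddCommGroup DH] [AddCommGroup D'H] [AddCommGroup XtH]
    (δL : UL →+ D'L) (jL : XtL →+ UL) (iL : DL →+ XtL)
    (δH : UH →+ D'H) (jH : XtH →+ UH) (iH : DH →+ XtH)
    (ΦU : UL →+ UH) (ΦXt : XtL →+ XtH) (ΦD : DL →+ DH) (ΦD' : D'L →+ D'H)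
    (h1 : Function.Injective ΦD')
    (h2 : Function.Surjective ΦD)
    (h3 : ∀ a : UL, ΦD' (δL a) = δH (ΦU a))
    (h4 : ∀ a : UL, δL a = 0 → ∃ b : XtL, jL b = a)
    (h5 : ∀ b : XtL, jH (ΦXt b) = ΦU (jL b))
    (h6 : ∀ x : XtH, jH x = 0 → ∃ d : DH, iH d = x)
    (h7 : ∀ d : DL, ΦXt (iL d) = iH (ΦD d))
    (h8 : ∀ d : DL, jL (iL d) = 0) :
    ∀ a : UL, ΦU a = 0 → ∃ b : XtL, ΦXt b = 0 ∧ jL b = a := by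
  intro a ha
  obtain ⟨b, hb⟩ := h4 a (h1 (by rw [h3, ha, map_zero, map_zero]))
  obtain ⟨d, hd⟩ := h6 (ΦXt b) (by rw [h5, hb, ha])
  obtain ⟨e, he⟩ := h2 d
  refine ⟨b - iL e, ?_, ?_⟩
  · rw [map_sub, h7, he, hd, sub_self]
  · rw [map_sub, h8, hb, sub_zero]
end

section
/- Let U′_L, D_L, Y_L, X̃_L, X_L, U_L and D_H, Y_H, X̃_H, X_H, U_H, U′_H be abelian groups with group homomorphisms δ_L : U′_L → D_L, δ₀_L : U′_L → Y_L, i_L : D_L → X̃_L, i₀_L : Y_L → X_L, j_L : X̃_L → U_L, j₀_L : X_L → U_L, π_L : D_L → Y_L, σ_L : X̃_L → X_L, and δ_H : U′_H → D_H, δ₀_H : U′_H → Y_H, i_H : D_H → X̃_H, i₀_H : Y_H → X_H, j_H : X̃_H → U_H, j₀_H : X_H → U_H, π_H : D_H → Y_H, σ_H : X̃_H → X_H, together with homomorphisms Φ_X̃ : X̃_L → X̃_H, Φ_X : X_L → X_H, Φ_U : U_L → U_H, Φ_D : D_L → D_H, satisfying: (1) ker j_L ⊆ im i_L; (2) ker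 i₀_L ⊆ im δ₀_L; (3) i_L ∘ δ_L = 0; (4) π_L ∘ δ_L = δ₀_L; (5) σ_L ∘ i_L = i₀_L ∘ π_L; (6) j_L = j₀_L ∘ σ_L; (7) σ_L is surjective; (8) ker j_H ⊆ im i_H; (9) ker i₀_H ⊆ im δ₀_H; (10) π_H ∘ δ_H = δ₀_H; (11) i_H ∘ δ_H = 0; (12) σ_H ∘ i_H = i₀_H ∘ π_H; (13) j_H = j₀_H ∘ σ_H; (14) Φ_U ∘ j_L = j_H ∘ Φ_X̃; (15) Φ_U ∘ j₀_L = j₀_H ∘ Φ_X; (16) Φ_X ∘ σ_L = σ_H ∘ Φ_X̃; (17) Φ_X̃ ∘ i_L = i_H ∘ Φ_D; (18) the restriction of Φ_X̃ ∘ i_L to ker π_L is injective; (19) for every x ∈ D_H with π_H(x) = 0 there exists e ∈ D_L with π_L(e) = 0 and Φ_D(e) = x. Then σ_L maps ker Φ_X̃ into ker Φ_X, and the restriction σ_L : ker Φ_X̃ → ker Φ_X is a bijection. -/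
/-- the single blow-up step of the main theorem for p = 1:
σ_L restricts to a bijection ker Φ_X̃ → ker Φ_X. -/
theorem stmt_8 {U'L DL YL XtL XL UL DH YH XtH XH UH U'H : Type*}
    [AddCommGroup U'L] [AddCommGroup DL] [AddCommGroup YL] [AddCommGroup XtL]
    [AddCommGroup XL] [AddCommGroup UL] [AddCommGroup DH] [AddCommGroup YH]
    [AddCommGroup XtH] [AddCommGroup XH] [AddCommGroup UH] [AddCommGroup U'H]
    (δL : U'L →+ DL) (δ0L : U'L →+ YL) (iL : DL →+ XtL) (i0L : YL →+ XL)
    (jL : XtL →+ UL) (j0L : XL →+ UL) (πL : DL →+ YL) (σL : XtL →+ XL)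
    (δH : U'H →+ DH) (δ0H : U'H →+ YH) (iH : DH →+ XtH) (i0H : YH →+ XH)
    (jH : XtH →+ UH) (j0H : XH →+ UH) (πH : DH →+ YH) (σH : XtH →+ XH)
    (ΦXt : XtL →+ XtH) (ΦX : XL →+ XH) (ΦU : UL →+ UH) (ΦD : DL →+ DH)
    (h1 : ∀ a : XtL, jL a = 0 → ∃ b : DL, iL b = a)
    (h2 : ∀ y : YL, i0L y = 0 → ∃ c : U'L, δ0L c = y)
    (h3 : ∀ c : U'L, iL (δL c) = 0)
    (h4 : ∀ c : U'L, πL (δL c) = δ0L c)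
    (h5 : ∀ b : DL, σL (iL b) = i0L (πL b))
    (h6 : ∀ a : XtL, jL a = j0L (σL a))
    (h7 : Function.Surjective σL)
    (h8 : ∀ x : XtH, jH x = 0 → ∃ d : DH, iH d = x)
    (h9 : ∀ y : YH, i0H y = 0 → ∃ u : U'H, δ0H u = y)
    (h10 : ∀ u : U'H, πH (δH u) = δ0H u)
    (h11 : ∀ u : U'H, iH (δH u) = 0)
    (h12 : ∀ d : DH, σH (iH d) = i0H (πH d))
    (h13 : ∀ x : XtH, jH x = j0H (σH x))
    (h14 : ∀ a : XtL, ΦU (jL a) = jH (ΦXt a))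
    (h15 : ∀ a : XL, ΦU (j0L a) = j0H (ΦX a))
    (h16 : ∀ a : XtL, ΦX (σL a) = σH (ΦXt a))
    (h17 : ∀ d : DL, ΦXt (iL d) = iH (ΦD d))
    (h18 : ∀ b b' : DL, πL b = 0 → πL b' = 0 → ΦXt (iL b) = ΦXt (iL b') → b = b')
    (h19 : ∀ x : DH, πH x = 0 → ∃ e : DL, πL e = 0 ∧ ΦD e = x) :
    Set.BijOn σL {a : XtL | ΦXt a = 0} {b : XL | ΦX b = 0} := by
  refine ⟨?_, ?_, ?_⟩
  · intro a ha
    have ha' : ΦXt a = 0 := ha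
    show ΦX (σL a) = 0
    rw [h16, ha', map_zero]
  · intro a ha a' ha' hs
    have ha1 : ΦXt a = 0 := ha
    have ha2 : ΦXt a' = 0 := ha'
    have hσ : σL (a - a') = 0 := by
      rw [map_sub]
      exact sub_eq_zero.mpr hs
    obtain ⟨b, hb⟩ := h1 (a - a') (by rw [h6, hσ, map_zero])
    obtain ⟨c, hc⟩ := h2 (πL b) (by rw [← h5, hb, hσ])
    have hi : iL (b - δL c) = a - a' := by rw [map_sub, h3, sub_zero, hb]
    have h0 : b - δL c = 0 := by
      apply h18 _ _ _ (map_zero _)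
      · rw [hi, map_sub, ha1, ha2, map_zero, map_zero, sub_zero]
      · rw [map_sub, h4, hc, sub_self]
    rw [h0, map_zero] at hi
    exact sub_eq_zero.mp hi.symm
  · intro x hx
    have hx' : ΦX x = 0 := hx
    obtain ⟨a, rfl⟩ := h7 x
    rw [h16] at hx'
    obtain ⟨d, hd⟩ := h8 (ΦXt a) (by rw [h13, hx', map_zero])
    obtain ⟨u, hu⟩ := h9 (πH d) (by rw [← h12, hd, hx'])
    obtain ⟨e, he, hde⟩ := h19 (d - δH u) (by rw [map_sub, h10, hu, sub_self])
    refine ⟨a - iL e, ?_, ?_⟩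
    · show ΦXt (a - iL e) = 0
      rw [map_sub, h17, hde, map_sub, h11, sub_zero, hd, sub_self]
    · rw [map_sub, h5, he, map_zero, sub_zero]
end

section
/- Let U′_L, D_L, D′_L, Y_L, X̃_L, X_L, U_L and D_H, D′_H, Y_H, X̃_H, X_H, U_H, U″_H, X̃′_H, X′_H be abelian groups with group homomorphisms (L-level) δ_L : U′_L → D_L, δ₀_L : U′_L → Y_L, i_L : D_L → X̃_L, i₀_L : Y_L → X_L, j_L : X̃_L → U_L, j₀_L : X_L → U_L, π_L : D_L → Y_L, σ_L : X̃_L → X_L, ∂_L : U_L → D′_L, and (H-level) i_H : D_H → X̃_H, ī₀ : Y_H → X_H, π_H : D_H → Y_H, δ_H : U″_H → D_H, δ₀_H : U″_H → Y_H, j_H^{+} : X̃′_H → U″_H, j₀_H^{+} : X′_H → U″_H, σ_H^{+} : X̃′_H → X′_H, j_H : X̃_H → U_H, j₀_H : X_H → U_H, σ_H : X̃_H → X_H, ∂_H : U_H → D′_H, together with homomorphisms Φ_X̃ : X̃_L → X̃_H, Φ_X : X_L → X_H, Φ_U : U_L → U_H, Φ_D : D_L → D_H, Φ_{D′} : D′_L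 → D′_H, Φ_Y : Y_L → Y_H, satisfying: (1) ker j_L ⊆ im i_L; (2) ker i₀_L ⊆ im δ₀_L; (3) ker j₀_L ⊆ im i₀_L; (4) i_L ∘ δ_L = 0; (5) π_L ∘ δ_L = δ₀_L; (6) σ_L ∘ i_L = i₀_L ∘ π_L; (7) j_L = j₀_L ∘ σ_L; (8) ker ∂_L ⊆ im j_L; (9) j_L ∘ i_L = 0; (10) ker i_H ⊆ im δ_H; (11) δ_H ∘ j_H^{+} = 0; (12) ker δ₀_H ⊆ im j₀_H^{+}; (13) δ₀_H = π_H ∘ δ_H; (14) j_H^{+} = j₀_H^{+} ∘ σ_H^{+}; (15) σ_H^{+} is surjective; (16) ker j_H ⊆ im i_H; (17) Φ_Y ∘ π_L = π_H ∘ Φ_D; (18) Φ_X̃ ∘ i_L = i_H ∘ Φ_D; (19) Φ_{D′} ∘ ∂_L = ∂_H ∘ Φ_U; (20) Φ_U ∘ j_L = j_H ∘ Φ_X̃; (21) Φ_U ∘ j₀_L = j₀_H ∘ Φ_X; (22) Φ_X ∘ σ_L = σ_H ∘ Φ_X̃; (23) Φ_X ∘ i₀_L = ī₀ ∘ Φ_Y;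 (24) Φ_D is bijective; (25) Φ_{D′} is injective; (26) ī₀ ∘ Φ_Y is injective. Then σ_L maps ker Φ_X̃ into ker Φ_X, and the restriction σ_L : ker Φ_X̃ → ker Φ_X is a bijection. -/
/-- the single blow-up step of the main theorem for p = n−2:
σ_L restricts to a bijection ker Φ_X̃ → ker Φ_X. -/
theorem stmt_9 {U'L DL D'L YL XtL XL UL DH D'H YH XtH XH UH U''H Xt'H X'H : Type*}
    [AddCommGroup U'L] [AddCommGroup DL] [AddCommGroup D'L] [AddCommGroup YL]
    [AddCommGroup XtL] [AddCommGroup XL] [AddCommGroup UL] [AddCommGroup DH]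
    [AddCommGroup D'H] [AddCommGroup YH] [AddCommGroup XtH] [AddCommGroup XH]
    [AddCommGroup UH] [AddCommGroup U''H] [AddCommGroup Xt'H] [AddCommGroup X'H]
    -- L-level maps
    (δL : U'L →+ DL) (δ0L : U'L →+ YL) (iL : DL →+ XtL) (i0L : YL →+ XL)
    (jL : XtL →+ UL) (j0L : XL →+ UL) (πL : DL →+ YL) (σL : XtL →+ XL)
    (bdL : UL →+ D'L)
    -- H-level maps
    (iH : DH →+ XtH) (ibar0 : YH →+ XH) (πH : DH →+ YH)
    (δH : U''H →+ DH) (δ0H : U''H →+ YH)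
    (jHp : Xt'H →+ U''H) (j0Hp : X'H →+ U''H) (σHp : Xt'H →+ X'H)
    (jH : XtH →+ UH) (j0H : XH →+ UH) (σH : XtH →+ XH) (bdH : UH →+ D'H)
    -- cycle class maps
    (ΦXt : XtL →+ XtH) (ΦX : XL →+ XH) (ΦU : UL →+ UH) (ΦD : DL →+ DH)
    (ΦD' : D'L →+ D'H) (ΦY : YL →+ YH)
    (h1 : ∀ a : XtL, jL a = 0 → ∃ b : DL, iL b = a)
    (h2 : ∀ y : YL, i0L y = 0 → ∃ c : U'L, δ0L c = y)
    (h3 : ∀ a : XL, j0L a = 0 → ∃ y : YL, i0L y = a)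
    (h4 : ∀ c : U'L, iL (δL c) = 0)
    (h5 : ∀ c : U'L, πL (δL c) = δ0L c)
    (h6 : ∀ b : DL, σL (iL b) = i0L (πL b))
    (h7 : ∀ a : XtL, jL a = j0L (σL a))
    (h8 : ∀ u : UL, bdL u = 0 → ∃ a : XtL, jL a = u)
    (h9 : ∀ b : DL, jL (iL b) = 0)
    (h10 : ∀ x : DH, iH x = 0 → ∃ u : U''H, δH u = x)
    (h11 : ∀ x : Xt'H, δH (jHp x) = 0)
    (h12 : ∀ u : U''H, δ0H u = 0 → ∃ x : X'H, j0Hp x = u)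
    (h13 : ∀ u : U''H, δ0H u = πH (δH u))
    (h14 : ∀ x : Xt'H, jHp x = j0Hp (σHp x))
    (h15 : Function.Surjective σHp)
    (h16 : ∀ x : XtH, jH x = 0 → ∃ d : DH, iH d = x)
    (h17 : ∀ b : DL, ΦY (πL b) = πH (ΦD b))
    (h18 : ∀ b : DL, ΦXt (iL b) = iH (ΦD b))
    (h19 : ∀ u : UL, ΦD' (bdL u) = bdH (ΦU u))
    (h20 : ∀ a : XtL, ΦU (jL a) = jH (ΦXt a))
    (h21 : ∀ a : XL, ΦU (j0L a) = j0H (ΦX a))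
    (h22 : ∀ a : XtL, ΦX (σL a) = σH (ΦXt a))
    (h23 : ∀ y : YL, ΦX (i0L y) = ibar0 (ΦY y))
    (h24 : Function.Bijective ΦD)
    (h25 : Function.Injective ΦD')
    (h26 : Function.Injective (fun y : YL => ibar0 (ΦY y))) :
    Set.BijOn σL {a : XtL | ΦXt a = 0} {b : XL | ΦX b = 0} := by
  refine ⟨?_, ?_, ?_⟩
  · intro a ha
    simp only [Set.mem_setOf_eq] at ha ⊢
    rw [h22, ha, map_zero]
  · have key : ∀ a : XtL, ΦXt a = 0 → σL a = 0 → a = 0 := by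
      intro a ha hs
      obtain ⟨b, rfl⟩ := h1 a (by rw [h7, hs, map_zero])
      rw [h6] at hs
      have hy : πL b = 0 := h26 (by
        show ibar0 (ΦY (πL b)) = ibar0 (ΦY 0)
        rw [← h23, hs]; simp)
      rw [h18] at ha
      obtain ⟨u, hu⟩ := h10 _ ha
      obtain ⟨x, hx⟩ := h12 u (by rw [h13, hu, ← h17, hy, map_zero])
      obtain ⟨x', rfl⟩ := h15 x
      rw [← h14] at hx
      have hb : b = 0 := h24.1 (by rw [← hu, ← hx, h11, map_zero])
      rw [hb, map_zero]
    intro a ha b hb hab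
    simp only [Set.mem_setOf_eq] at ha hb
    exact sub_eq_zero.1 (key (a - b) (by rw [map_sub, ha, hb, sub_zero])
      (by rw [map_sub, hab, sub_self]))
  · intro b hb
    simp only [Set.mem_setOf_eq] at hb
    have hU : ΦU (j0L b) = 0 := by rw [h21, hb, map_zero]
    obtain ⟨a, ha⟩ := h8 (j0L b) (h25 (by rw [h19, hU, map_zero, map_zero]))
    obtain ⟨d, hd⟩ := h16 (ΦXt a) (by rw [← h20, ha, hU])
    obtain ⟨e, rfl⟩ := h24.2 d
    have h0 : ΦXt (a - iL e) = 0 := by rw [map_sub, h18, hd, sub_self]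
    obtain ⟨y, hy⟩ := h3 (σL (a - iL e) - b) (by
      rw [map_sub, ← h7, map_sub, h9, ha, sub_zero, sub_self])
    have hy0 : y = 0 := h26 (by
      show ibar0 (ΦY y) = ibar0 (ΦY 0)
      rw [← h23, hy, map_sub, h22, h0, hb]; simp)
    refine ⟨a - iL e, h0, ?_⟩
    rw [hy0, map_zero] at hy
    exact sub_eq_zero.1 hy.symm
end
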